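/- arXiv:2403.18060 — 7 statements merged into one kernel-verified Lean document; each statement's English description precedes it below -/
import Mathlib

section
/- In the Impish-start cordiality game on the path P_4, and also in the Impish-start-with-pass variant, Admirable has a strategy guaranteeing final discrepancy at most 1, and every complete play ends with discrepancy at least 1; hence c'_g(P_4) = c*_g(P_4) = 1. -/
open Finset

variable {V : Type} [Fintype V] [DecidableEq V]

/-- The number of edges of `G` with exactly one endpoint in `S`
(each such edge is counted once, as the ordered pair whose first
coordinate lies in `S`). This is the cut function `φ`. -/
def cutSize (G : SimpleGraph V) [DecidableRel G.Adj] (S : Finset V) : ℕ :=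
  ((univ ×ˢ univ).filter (fun p : V × V => G.Adj p.1 p.2 ∧ p.1 ∈ S ∧ p.2 ∉ S)).card

/-- The number of edges of `G`. -/
def edgeCount (G : SimpleGraph V) [DecidableRel G.Adj] : ℕ := G.edgeFinset.card

/-- The (unsigned) discrepancy `|e₁ - e₀|` of the labeling in which exactly the
vertices of `S` are labeled `0`: `e₁ = φ(S)` and `e₀ = |E| - φ(S)`. -/
def cordDisc (G : SimpleGraph V) [DecidableRel G.Adj] (S : Finset V) : ℤ :=
  |2 * (cutSize G S : ℤ) - (edgeCount G : ℤ)|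

/-- The signed discrepancy `e₁ - e₀` of the labeling in which exactly the
vertices of `S` are labeled `0`. -/
def balDisc (G : SimpleGraph V) [DecidableRel G.Adj] (S : Finset V) : ℤ :=
  2 * (cutSize G S : ℤ) - (edgeCount G : ℤ)

/-- The min-max value of the vertex-selection game: Admirable (the minimizer)
and Impish (the maximizer) alternately select unselected vertices from `rem`
until none remain; `A` is the set of vertices selected by Admirable so far,
`turn = true` means it is Admirable's turn, and `p` is the number of times
Impish may still pass his turn.  The final payoff is `payoff A` where `A` is
the set of all vertices Admirable selected.  `gameVal payoff p rem A turn ≤ k`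
holds iff Admirable has a strategy guaranteeing payoff at most `k`, and
`gameVal payoff p rem A turn ≥ k` holds iff Impish has a strategy
guaranteeing payoff at least `k`. -/
def gameVal (payoff : Finset V → ℤ) (p : ℕ) (rem A : Finset V) (turn : Bool) : ℤ :=
  if hrem : rem.Nonempty then
    if turn then
      rem.attach.inf' (Finset.attach_nonempty_iff.mpr hrem)
        (fun v => gameVal payoff p (rem.erase v.1) (insert v.1 A) false)
    else
      let m := rem.attach.sup' (Finset.attach_nonempty_iff.mpr hrem)
        (fun v => gameVal payoff p (rem.erase v.1) A true)
      if hp : p = 0 then m else max m (gameVal payoff (p - 1) rem A true)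
  else payoff A
termination_by rem.card + p
decreasing_by
  · exact Nat.add_lt_add_right (Finset.card_erase_lt_of_mem v.2) p
  · exact Nat.add_lt_add_right (Finset.card_erase_lt_of_mem v.2) p
  · omega

/-- The game cordiality number `c_g(G)`: Admirable moves first. -/
def cg (G : SimpleGraph V) [DecidableRel G.Adj] : ℤ :=
  gameVal (cordDisc G) 0 univ ∅ true

/-- The Impish-start game cordiality number `c'_g(G)`. -/
def cg' (G : SimpleGraph V) [DecidableRel G.Adj] : ℤ :=
  gameVal (cordDisc G) 0 univ ∅ false

/-- The Impish-start-with-pass game cordiality number `c*_g(G)`: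
Impish moves first and may pass at most once. -/
def cgStar (G : SimpleGraph V) [DecidableRel G.Adj] : ℤ :=
  gameVal (cordDisc G) 1 univ ∅ false

/-- The game balance number `b_g(G)`: Admirable moves first, payoff is the
signed discrepancy `e₁ - e₀`. -/
def bg (G : SimpleGraph V) [DecidableRel G.Adj] : ℤ :=
  gameVal (balDisc G) 0 univ ∅ true

/-- The path `P_n` on vertices `v_1, …, v_n`, encoded as `0, …, n-1 : Fin n`. -/
def pathG (n : ℕ) : SimpleGraph (Fin n) :=
  SimpleGraph.fromRel (fun i j => (i : ℕ) + 1 = (j : ℕ))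

instance pathGDecidable (n : ℕ) : DecidableRel (pathG n).Adj :=
  fun a b => decidable_of_iff _ (SimpleGraph.fromRel_adj _ a b).symm

/-- `gameVal` by structural recursion on a bound `n` for the number of remaining turns,
which lets the kernel evaluate it. -/
def boundedGameVal (payoff : Finset V → ℤ) : ℕ → ℕ → Finset V → Finset V → Bool → ℤ
  | 0, _, _, A, _ => payoff A
  | n + 1, p, rem, A, turn =>
    if hrem : rem.Nonempty then
      if turn then
        rem.attach.inf' (Finset.attach_nonempty_iff.mpr hrem)
          (fun v => boundedGameVal payoff n p (rem.erase v.1) (insert v.1 A) false)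
      else
        let m := rem.attach.sup' (Finset.attach_nonempty_iff.mpr hrem)
          (fun v => boundedGameVal payoff n p (rem.erase v.1) A true)
        if p = 0 then m else max m (boundedGameVal payoff n (p - 1) rem A true)
    else payoff A

theorem gameVal_eq_boundedGameVal {W : Type} [DecidableEq W] (payoff : Finset W → ℤ)
    (n p : ℕ) (rem A : Finset W) (turn : Bool) (hn : rem.card + p ≤ n) :
    gameVal payoff p rem A turn = boundedGameVal payoff n p rem A turn := by
  induction n generalizing p rem A turn with
  | zero =>
    obtain rfl : rem = ∅ := Finset.card_eq_zero.mp (by omega)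
    simp [gameVal, boundedGameVal]
  | succ n ih =>
    have ih_erase (v : rem) (B : Finset W) (t : Bool) :
        gameVal payoff p (rem.erase v.1) B t = boundedGameVal payoff n p (rem.erase v.1) B t :=
      ih _ _ _ _ (by have := Finset.card_erase_lt_of_mem v.2; omega)
    rw [gameVal, boundedGameVal]
    simp only [ih_erase]
    split_ifs with hrem hturn hp
    · rfl
    · rfl
    · rw [ih _ _ _ _ (by omega)]
    · rfl

/-- the Impish-start and Impish-start-with-pass game cordiality
numbers of `P₄` are `1`. -/
theorem cg'_cgStar_path4 : cg' (pathG 4) = 1 ∧ cgStar (pathG 4) = 1 := by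
  constructor
  · rw [cg', gameVal_eq_boundedGameVal _ 4 _ _ _ _ (by simp)]
    decide +kernel
  · rw [cgStar, gameVal_eq_boundedGameVal _ 5 _ _ _ _ (by simp)]
    decide +kernel
end

section
/- In each of the three variants of the cordiality game on the path P_5 (Admirable moves first; Impish moves first; Impish moves first and may pass once), Admirable has a strategy guaranteeing final discrepancy at most 2; hence c_g(P_5) ≤ 2, c'_g(P_5) ≤ 2, and c*_g(P_5) ≤ 2. -/
open Finset

variable {V : Type} [Fintype V] [DecidableEq V]

/-- Admirable can force the final set to satisfy `good` in the vertex-selection game, where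
`fuel` bounds the number of remaining moves and passes. -/
def AdmirableForces (good : Finset V → Prop) :
    (fuel p : ℕ) → (rem A : Finset V) → (turn : Bool) → Prop
  | 0, _, rem, A, _ => rem = ∅ ∧ good A
  | fuel + 1, p, rem, A, true =>
      (rem = ∅ ∧ good A) ∨
        ∃ v ∈ rem, AdmirableForces good fuel p (rem.erase v) (insert v A) false
  | fuel + 1, p, rem, A, false =>
      (rem = ∅ ∧ good A) ∨ (rem ≠ ∅ ∧
        (∀ v ∈ rem, AdmirableForces good fuel p (rem.erase v) A true) ∧
        (p = 0 ∨ AdmirableForces good fuel (p - 1) rem A true))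

instance AdmirableForces.instDecidable (good : Finset V → Prop) [DecidablePred good] :
    (fuel p : ℕ) → (rem A : Finset V) → (turn : Bool) →
      Decidable (AdmirableForces good fuel p rem A turn)
  | 0, _, rem, A, _ => inferInstanceAs (Decidable (rem = ∅ ∧ good A))
  | fuel + 1, p, rem, A, true =>
      have := AdmirableForces.instDecidable good fuel
      inferInstanceAs (Decidable ((rem = ∅ ∧ good A) ∨
        ∃ v ∈ rem, AdmirableForces good fuel p (rem.erase v) (insert v A) false))
  | fuel + 1, p, rem, A, false =>
      have := AdmirableForces.instDecidable good fuel
      inferInstanceAs (Decidable ((rem = ∅ ∧ good A) ∨ (rem ≠ ∅ ∧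
        (∀ v ∈ rem, AdmirableForces good fuel p (rem.erase v) A true) ∧
        (p = 0 ∨ AdmirableForces good fuel (p - 1) rem A true))))

theorem gameVal_empty {W : Type} [DecidableEq W] (payoff : Finset W → ℤ) (p : ℕ)
    (A : Finset W) (turn : Bool) :
    gameVal payoff p ∅ A turn = payoff A := by
  rw [gameVal]; simp

theorem AdmirableForces.gameVal_le {W : Type} [DecidableEq W] {payoff : Finset W → ℤ}
    {good : Finset W → Prop} {k : ℤ}
    (hgood : ∀ S, good S → payoff S ≤ k) {fuel p : ℕ} {rem A : Finset W} {turn : Bool}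
    (h : AdmirableForces good fuel p rem A turn) : gameVal payoff p rem A turn ≤ k := by
  induction fuel generalizing p rem A turn with
  | zero =>
    obtain ⟨rfl, hA⟩ := h
    exact (gameVal_empty payoff p A turn).trans_le (hgood A hA)
  | succ fuel ih =>
    cases turn with
    | true =>
      rcases h with ⟨rfl, hA⟩ | ⟨v, hv, h⟩
      · exact (gameVal_empty payoff p A true).trans_le (hgood A hA)
      · rw [gameVal, dif_pos ⟨v, hv⟩, if_pos rfl]
        exact (Finset.inf'_le _ (Finset.mem_attach rem ⟨v, hv⟩)).trans (ih h)
    | false =>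
      rcases h with ⟨rfl, hA⟩ | ⟨hrem, hmove, hpass⟩
      · exact (gameVal_empty payoff p A false).trans_le (hgood A hA)
      · have hsup := Finset.sup'_le
          (Finset.attach_nonempty_iff.mpr (Finset.nonempty_iff_ne_empty.mpr hrem))
          (fun v : rem => gameVal payoff p (rem.erase v.1) A true)
          (fun v _ => ih (hmove v.1 v.2))
        rw [gameVal, dif_pos (Finset.nonempty_iff_ne_empty.mpr hrem), if_neg Bool.false_ne_true]
        by_cases hp : p = 0
        · simpa only [dif_pos hp] using hsup
        · simpa only [dif_neg hp] using max_le hsup (ih (hpass.resolve_left hp))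

/-- A set of vertices of `P₅` is neither trivial nor a color class of the proper 2-coloring. -/
def IsUnextremal (S : Finset (Fin 5)) : Prop :=
  S ≠ ∅ ∧ S ≠ univ ∧ S ≠ {0, 2, 4} ∧ S ≠ {1, 3}

instance : DecidablePred IsUnextremal := fun S =>
  inferInstanceAs (Decidable (S ≠ ∅ ∧ S ≠ univ ∧ S ≠ {0, 2, 4} ∧ S ≠ {1, 3}))

theorem cordDisc_path5_le (S : Finset (Fin 5)) (hS : IsUnextremal S) :
    cordDisc (pathG 5) S ≤ 2 := by
  revert S
  decide +kernel

/-- in all three variants of the cordiality game on `P₅`,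
Admirable can guarantee discrepancy at most `2`. -/
theorem cg_path5 : cg (pathG 5) ≤ 2 ∧ cg' (pathG 5) ≤ 2 ∧ cgStar (pathG 5) ≤ 2 := by
  have forces : AdmirableForces IsUnextremal 5 0 univ ∅ true ∧
      AdmirableForces IsUnextremal 5 0 univ ∅ false ∧
      AdmirableForces IsUnextremal 6 1 univ ∅ false := by
    decide +kernel
  exact ⟨forces.1.gameVal_le cordDisc_path5_le, forces.2.1.gameVal_le cordDisc_path5_le,
    forces.2.2.gameVal_le cordDisc_path5_le⟩
end

section
/- In the cordiality game on the path P_6 with Admirable moving first, the value under optimal play equals 1: Admirable has a strategy guaranteeing final discrepancy at most 1, and every complete play ends with discrepancy at least 1; hence c_g(P_6) = 1. -/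
open Finset

variable {V : Type} [Fintype V] [DecidableEq V]

/-- Admirable can force a final payoff of at most `k` in the `n` remaining moves
(without passes). -/
def CanForceLE (payoff : Finset V → ℤ) (k : ℤ) : ℕ → Finset V → Finset V → Bool → Prop
  | 0, _, A, _ => payoff A ≤ k
  | n + 1, rem, A, true => ∃ v ∈ rem, CanForceLE payoff k n (rem.erase v) (insert v A) false
  | n + 1, rem, A, false => ∀ v ∈ rem, CanForceLE payoff k n (rem.erase v) A true

instance CanForceLE.decidable (payoff : Finset V → ℤ) (k : ℤ) :
    ∀ n rem A turn, Decidable (CanForceLE payoff k n rem A turn)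
  | 0, _, A, _ => inferInstanceAs (Decidable (payoff A ≤ k))
  | n + 1, rem, A, true =>
    have := fun v => CanForceLE.decidable payoff k n (rem.erase v) (insert v A) false
    inferInstanceAs (Decidable (∃ v ∈ rem, _))
  | n + 1, rem, A, false =>
    have := fun v => CanForceLE.decidable payoff k n (rem.erase v) A true
    inferInstanceAs (Decidable (∀ v ∈ rem, _))

theorem gameVal_le_of_canForceLE {W : Type} [DecidableEq W] {payoff : Finset W → ℤ} {k : ℤ}
    {n : ℕ} {rem A : Finset W} {turn : Bool} (hn : rem.card = n)
    (h : CanForceLE payoff k n rem A turn) :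
    gameVal payoff 0 rem A turn ≤ k := by
  induction n generalizing rem A turn with
  | zero =>
    obtain rfl := Finset.card_eq_zero.mp hn
    rw [gameVal]
    simpa [CanForceLE] using h
  | succ n ih =>
    have hrem : rem.Nonempty := Finset.card_pos.mp (by omega)
    have hcard : ∀ v ∈ rem, (rem.erase v).card = n := fun v hv => by
      rw [Finset.card_erase_of_mem hv, hn, Nat.add_sub_cancel]
    rw [gameVal]
    cases turn with
    | true =>
      obtain ⟨v, hv, hforce⟩ := h
      simp only [hrem, dite_true, if_true, Finset.inf'_le_iff]
      exact ⟨⟨v, hv⟩, Finset.mem_attach _ _, ih (hcard v hv) hforce⟩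
    | false =>
      simp only [hrem, dite_true, Bool.false_eq_true, if_false, Finset.sup'_le_iff]
      exact fun v _ => ih (hcard v v.2) (h v v.2)

theorem le_gameVal {W : Type} [DecidableEq W] {payoff : Finset W → ℤ} {k : ℤ}
    (h : ∀ S, k ≤ payoff S) (p : ℕ) (rem A : Finset W) (turn : Bool) :
    k ≤ gameVal payoff p rem A turn := by
  fun_induction gameVal payoff p rem A turn with
  | case1 p rem A hrem ih => exact Finset.le_inf' _ _ fun v _ => ih v
  | case2 rem A turn hrem hturn m ih =>
    obtain ⟨v, hv⟩ := hrem
    exact Finset.le_sup'_of_le _ (Finset.mem_attach _ ⟨v, hv⟩) (ih ⟨v, hv⟩)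
  | case3 p rem A turn hrem hturn m hp ih ih' => exact le_max_of_le_right ih'
  | case4 p rem A turn hrem => exact h A

theorem one_le_cordDisc_of_odd (G : SimpleGraph V) [DecidableRel G.Adj] (h : Odd (edgeCount G))
    (S : Finset V) : 1 ≤ cordDisc G S := by
  obtain ⟨m, hm⟩ := h
  refine Int.one_le_abs ?_
  omega

theorem edgeCount_pathG_six : edgeCount (pathG 6) = 5 := by decide +kernel

/-- the game cordiality number of `P₆` is `1`. -/
theorem cg_path6 : cg (pathG 6) = 1 := by
  apply le_antisymm
  · exact gameVal_le_of_canForceLE (n := 6) (by simp) (by decide +kernel)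
  · refine le_gameVal (one_le_cordDisc_of_odd _ ?_) _ _ _ _
    rw [edgeCount_pathG_six]
    decide
end

section
/- For every integer n ≥ 3, in the cordiality game on the path P_n with Admirable moving first, Admirable has a strategy guaranteeing final discrepancy at most (n−3)/3 if n ≡ 0 (mod 3), at most (n−1)/3 if n ≡ 1 (mod 3), and at most (n+1)/3 if n ≡ 2 (mod 3); in particular c_g(P_n) is at most the corresponding value. -/
open Finset

variable {V : Type} [Fintype V] [DecidableEq V]

variable {W : Type} [DecidableEq W]

/-- Every `σ`-pair outside `R` has exactly one vertex in `A`, and no `σ`-pair is half contained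
in `R`. Fixed points of `σ` are unconstrained. -/
structure PairedState (σ : W → W) (R A : Finset W) : Prop where
  closed : ∀ v ∈ R, σ v ∈ R
  split : ∀ v, v ∉ R → σ v ≠ v → (v ∈ A ↔ σ v ∉ A)

namespace PairedState

variable {σ : W → W} {R A : Finset W}

lemma erase_fixed (hσ : Function.Involutive σ) (h : PairedState σ R A) {v : W}
    (hv : σ v = v) : PairedState σ (R.erase v) A := by
  refine ⟨fun u hu => ?_, fun u hu hne => ?_⟩
  · rw [mem_erase] at hu ⊢
    exact ⟨fun e => hu.1 (by rw [← hσ u, e, hv]), h.closed u hu.2⟩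
  · exact h.split u (fun hR => hu (mem_erase.2 ⟨fun e => hne (e ▸ hv), hR⟩)) hne

lemma insert_fixed (hσ : Function.Involutive σ) (h : PairedState σ R A) {v : W}
    (hv : σ v = v) : PairedState σ R (insert v A) := by
  refine ⟨h.closed, fun u hu hne => ?_⟩
  have h₁ : u ≠ v := fun e => hne (e ▸ hv)
  have h₂ : σ u ≠ v := fun e => h₁ (by rw [← hσ u, e, hv])
  simpa [h₁, h₂] using h.split u hu hne

lemma erase_pair (hσ : Function.Involutive σ) (h : PairedState σ R A) (hd : Disjoint R A)
    {v : W} (hvR : v ∈ R) (hv : σ v ≠ v) :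
    PairedState σ ((R.erase v).erase (σ v)) (insert (σ v) A) := by
  refine ⟨fun u hu => ?_, fun u hu hne => ?_⟩
  · simp only [mem_erase] at hu ⊢
    exact ⟨fun e => hu.2.1 (hσ.injective e), fun e => hu.1 (by rw [← hσ u, e]),
      h.closed u hu.2.2⟩
  · have hvA : v ∉ A := disjoint_left.1 hd hvR
    by_cases h₁ : u = v
    · subst h₁
      simp [hv.symm, hvA]
    by_cases h₂ : u = σ v
    · subst h₂
      simp [hσ v, hv.symm, hvA]
    · have h₃ : σ u ≠ σ v := fun e => h₁ (hσ.injective e)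
      have h₄ : u ∉ R := fun hR => hu (by simp [h₁, h₂, hR])
      simpa [h₂, h₃] using h.split u h₄ hne

end PairedState

lemma gameVal_le_of_isEmpty {payoff : Finset W → ℤ} {A : Finset W} {turn : Bool} {K : ℤ}
    (h : payoff A ≤ K) : gameVal payoff 0 ∅ A turn ≤ K := by
  rw [gameVal]; simpa using h

lemma gameVal_true_le {payoff : Finset W → ℤ} {R A : Finset W} {K : ℤ} {v : W} (hv : v ∈ R)
    (h : gameVal payoff 0 (R.erase v) (insert v A) false ≤ K) :
    gameVal payoff 0 R A true ≤ K := by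
  rw [gameVal]
  simp only [show R.Nonempty from ⟨v, hv⟩, dite_true, if_true]
  exact inf'_le_of_le _ (mem_attach R ⟨v, hv⟩) h

lemma gameVal_false_le {payoff : Finset W → ℤ} {R A : Finset W} {K : ℤ} (hR : R.Nonempty)
    (h : ∀ v ∈ R, gameVal payoff 0 (R.erase v) A true ≤ K) :
    gameVal payoff 0 R A false ≤ K := by
  rw [gameVal]
  simp only [hR, dite_true, Bool.false_eq_true, if_false]
  exact sup'_le _ _ fun v _ => h v v.2

/-- The pairing strategy. The second conclusion treats the positions where one vertex `m` remains
in addition to a paired state in which `m` counts as belonging to Impish. -/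
lemma gameVal_le_of_pairedState_aux {σ : W → W} (hσ : Function.Involutive σ)
    {payoff : Finset W → ℤ} {K : ℤ}
    (hpay : ∀ A, PairedState σ ∅ A → payoff A ≤ K) (N : ℕ) :
    ∀ R A : Finset W, R.card ≤ N → Disjoint R A →
      (PairedState σ R A → ∀ turn, gameVal payoff 0 R A turn ≤ K) ∧
      (∀ m ∈ R, PairedState σ (R.erase m) A → Even ((R.erase m).filter fun v => σ v = v).card →
        gameVal payoff 0 R A false ≤ K) := by
  induction N with
  | zero =>
    intro R A hR hd
    obtain rfl : R = ∅ := by simpa using hR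
    exact ⟨fun h turn => gameVal_le_of_isEmpty (hpay A h), by simp⟩
  | succ N ih =>
    intro R A hR hd
    have card_erase {v : W} (hv : v ∈ R) : (R.erase v).card ≤ N := by
      rw [card_erase_of_mem hv]; omega
    have card_erase₂ {v w : W} (hv : v ∈ R) : ((R.erase v).erase w).card ≤ N :=
      (card_le_card (erase_subset _ _)).trans (card_erase hv)
    have disj {v : W} : Disjoint (R.erase v) A := hd.mono_left (erase_subset _ _)
    have disj₁ {v : W} : Disjoint (R.erase v) (insert v A) := by
      rw [disjoint_insert_right]; exact ⟨by simp, disj⟩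
    have disj₂ {v w : W} : Disjoint ((R.erase v).erase w) (insert w A) := by
      rw [disjoint_insert_right]; exact ⟨by simp, disj.mono_left (erase_subset _ _)⟩
    constructor
    · intro h turn
      rcases R.eq_empty_or_nonempty with rfl | hne
      · exact gameVal_le_of_isEmpty (hpay A h)
      cases turn with
      | false =>
        refine gameVal_false_le hne fun v hv => ?_
        by_cases hf : σ v = v
        · exact (ih _ A (card_erase hv) disj).1 (h.erase_fixed hσ hf) true
        · exact gameVal_true_le (mem_erase.2 ⟨hf, h.closed v hv⟩)
            ((ih _ _ (card_erase₂ hv) disj₂).1 (h.erase_pair hσ hd hv hf) false)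
      | true =>
        by_cases hex : ∃ w ∈ R, σ w = w
        · obtain ⟨w, hw, hf⟩ := hex
          exact gameVal_true_le hw ((ih _ _ (card_erase hw) disj₁).1
            ((h.erase_fixed hσ hf).insert_fixed hσ hf) false)
        · push Not at hex
          obtain ⟨w, hw⟩ := hne
          have hf := hex w hw
          refine gameVal_true_le hw ((ih _ _ (card_erase hw) disj₁).2 (σ w)
            (mem_erase.2 ⟨hf, h.closed w hw⟩) ?_ ?_)
          · have key := h.erase_pair hσ hd (h.closed w hw) (v := σ w) (by rwa [hσ w, ne_comm])
            rwa [hσ w, erase_right_comm] at key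
          · rw [filter_eq_empty_iff.2]
            · simp
            · intro x hx
              exact hex x (mem_of_mem_erase (mem_of_mem_erase hx))
    · intro m hm h hev
      refine gameVal_false_le ⟨m, hm⟩ fun v hv => ?_
      by_cases hvm : v = m
      · subst hvm
        exact (ih _ A (card_erase hv) disj).1 h true
      have hv' : v ∈ R.erase m := mem_erase.2 ⟨hvm, hv⟩
      by_cases hf : σ v = v
      · set F := (R.erase m).filter fun v => σ v = v with hF
        have hvF : v ∈ F := mem_filter.2 ⟨hv', hf⟩
        have hpos : 0 < (F.erase v).card := by
          have := card_pos.2 ⟨v, hvF⟩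
          rw [card_erase_of_mem hvF]
          obtain ⟨c, hc⟩ := hev
          omega
        obtain ⟨w, hw⟩ := card_pos.1 hpos
        have hwF := mem_of_mem_erase hw
        have hwv := ne_of_mem_erase hw
        obtain ⟨hwR, hwf⟩ := mem_filter.1 hwF
        have hset : ((R.erase v).erase w).erase m = ((R.erase m).erase v).erase w := by
          rw [erase_right_comm, erase_right_comm (a := v)]
        refine gameVal_true_le (mem_erase.2 ⟨hwv, mem_of_mem_erase hwR⟩)
          ((ih _ _ (card_erase₂ hv) disj₂).2 m
            (mem_erase.2 ⟨(ne_of_mem_erase hwR).symm, mem_erase.2 ⟨Ne.symm hvm, hm⟩⟩) ?_ ?_)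
        · rw [hset]
          exact ((h.erase_fixed hσ hf).erase_fixed hσ hwf).insert_fixed hσ hwf
        · rw [hset, filter_erase, filter_erase, card_erase_of_mem hw, card_erase_of_mem hvF]
          obtain ⟨c, hc⟩ := hev
          exact ⟨c - 1, by omega⟩
      · have hσv := h.closed v hv'
        have hset : ((R.erase v).erase (σ v)).erase m = ((R.erase m).erase v).erase (σ v) := by
          rw [erase_right_comm, erase_right_comm (a := v)]
        refine gameVal_true_le (mem_erase.2 ⟨hf, mem_of_mem_erase hσv⟩)
          ((ih _ _ (card_erase₂ hv) disj₂).2 m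
            (mem_erase.2 ⟨(ne_of_mem_erase hσv).symm, mem_erase.2 ⟨Ne.symm hvm, hm⟩⟩) ?_ ?_)
        · rw [hset]
          exact h.erase_pair hσ disj hv' hf
        · rw [hset, filter_erase, filter_erase, erase_eq_of_notMem, erase_eq_of_notMem]
          · exact hev
          · simp [hf]
          · simp [hσ v, Ne.symm hf]

/-- If Admirable can achieve payoff at most `K` by owning exactly one vertex of each pair of an
involution `σ`, then the value of the game is at most `K`. -/
lemma gameVal_univ_le_of_involutive [Fintype W] {σ : W → W} (hσ : Function.Involutive σ)
    {payoff : Finset W → ℤ} {K : ℤ}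
    (hpay : ∀ A : Finset W, (∀ v, σ v ≠ v → (v ∈ A ↔ σ v ∉ A)) → payoff A ≤ K) (turn : Bool) :
    gameVal payoff 0 univ ∅ turn ≤ K :=
  (gameVal_le_of_pairedState_aux hσ (fun A h => hpay A fun v => h.split v (by simp)) _
    univ ∅ le_rfl (disjoint_empty_right _)).1 ⟨by simp, by simp⟩ turn

/-- Membership of the `i`-th vertex, extended by `False` outside the path. -/
def natMem {n : ℕ} (A : Finset (Fin n)) (i : ℕ) : Prop := ∃ h : i < n, (⟨i, h⟩ : Fin n) ∈ A

lemma natMem_val {n : ℕ} (A : Finset (Fin n)) (v : Fin n) : natMem A v ↔ v ∈ A :=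
  ⟨fun ⟨_, h⟩ => h, fun h => ⟨v.2, h⟩⟩

lemma pathG_adj {n : ℕ} {u v : Fin n} :
    (pathG n).Adj u v ↔ (u : ℕ) + 1 = v ∨ (v : ℕ) + 1 = u := by
  rw [pathG, SimpleGraph.fromRel_adj]
  constructor
  · exact fun h => h.2
  · refine fun h => ⟨?_, h⟩
    rintro rfl
    omega

lemma edgeCount_pathG (n : ℕ) : edgeCount (pathG n) = n - 1 := by
  rw [edgeCount, ← card_range (n - 1)]
  symm
  refine card_bij (fun i hi => s(⟨i, by rw [mem_range] at hi; omega⟩,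
    ⟨i + 1, by rw [mem_range] at hi; omega⟩)) ?_ ?_ ?_
  · intro i hi
    simp [SimpleGraph.mem_edgeFinset, pathG_adj]
  · intro i hi j hj h
    simp only [Sym2.eq_iff, Fin.mk.injEq] at h
    omega
  · intro e
    induction e with
    | h u v =>
      intro h
      rw [SimpleGraph.mem_edgeFinset, SimpleGraph.mem_edgeSet, pathG_adj] at h
      rcases h with h | h
      · refine ⟨u, by rw [mem_range]; omega, ?_⟩
        rw [Sym2.eq_iff]
        exact Or.inl ⟨rfl, Fin.ext h⟩
      · refine ⟨v, by rw [mem_range]; omega, ?_⟩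
        rw [Sym2.eq_iff]
        exact Or.inr ⟨rfl, Fin.ext h⟩

open Classical in
lemma cutSize_pathG {n : ℕ} (A : Finset (Fin n)) :
    cutSize (pathG n) A = Nat.count (fun i => ¬(natMem A i ↔ natMem A (i + 1))) (n - 1) := by
  rw [cutSize, Nat.count_eq_card_filter_range]
  refine card_bij (fun p _ => min (p.1 : ℕ) p.2) ?_ ?_ ?_
  · rintro ⟨u, v⟩ h
    simp only [mem_filter, pathG_adj] at h
    obtain ⟨-, h | h, hu, hv⟩ := h
    · rw [min_eq_left (by simp only; omega), mem_filter, mem_range]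
      refine ⟨by simp only; omega, ?_⟩
      simp only [h, natMem_val]
      tauto
    · rw [min_eq_right (by simp only; omega), mem_filter, mem_range]
      refine ⟨by simp only; omega, ?_⟩
      simp only [h, natMem_val]
      tauto
  · rintro ⟨u, v⟩ h ⟨u', v'⟩ h' e
    simp only [mem_filter, pathG_adj] at h h' e
    obtain ⟨-, h, hu, hv⟩ := h
    obtain ⟨-, h', hu', hv'⟩ := h'
    have key : (u = u' ∧ v = v') ∨ (u = v' ∧ v = u') := by
      simp only [Fin.ext_iff]
      omega
    rcases key with ⟨rfl, rfl⟩ | ⟨rfl, rfl⟩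
    · rfl
    · exact absurd hu hv'
  · intro i hi
    rw [mem_filter, mem_range] at hi
    obtain ⟨hi, hne⟩ := hi
    have h₁ : i < n := by omega
    have h₂ : i + 1 < n := by omega
    have e₁ := natMem_val A ⟨i, h₁⟩
    have e₂ := natMem_val A ⟨i + 1, h₂⟩
    simp only at e₁ e₂
    rw [e₁, e₂] at hne
    by_cases hA : (⟨i, h₁⟩ : Fin n) ∈ A
    · exact ⟨(⟨i, h₁⟩, ⟨i + 1, h₂⟩), by simp [pathG_adj, hA]; tauto, by simp⟩
    · exact ⟨(⟨i + 1, h₂⟩, ⟨i, h₁⟩), by simp [pathG_adj, hA]; tauto, by simp⟩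

open Classical in
lemma count_changes_bounds (f : ℕ → Prop) (k : ℕ) : ∀ m, 3 * k ≤ m + 1 →
    (∀ j < k, ¬(f (3 * j) ↔ f (3 * j + 2))) →
    k ≤ Nat.count (fun i => ¬(f i ↔ f (i + 1))) m ∧
      Nat.count (fun i => ¬(f i ↔ f (i + 1))) m + k ≤ m := by
  induction k with
  | zero =>
    intro m _ _
    exact ⟨Nat.zero_le _, Nat.count_le _⟩
  | succ k ih =>
    intro m hm hf
    obtain ⟨c, rfl⟩ : ∃ c, m = 3 * k + 2 + c := ⟨m - (3 * k + 2), by omega⟩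
    have h := ih (3 * k) (by omega) fun j hj => hf j (by omega)
    have hk := hf k (by omega)
    have hlast : Nat.count (fun i => ¬(f i ↔ f (i + 1))) (3 * k + 2) =
        Nat.count (fun i => ¬(f i ↔ f (i + 1))) (3 * k) + 1 := by
      rw [Nat.count_succ, Nat.count_succ]
      by_cases h₀ : f (3 * k) <;> by_cases h₁ : f (3 * k + 1) <;>
        by_cases h₂ : f (3 * k + 2) <;> simp_all
    rw [Nat.count_add, hlast]
    have := Nat.count_le (fun i => ¬(f (3 * k + 2 + i) ↔ f (3 * k + 2 + i + 1))) (n := c)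
    simp only [add_assoc] at this ⊢
    omega

/-- The involution exchanging the two ends of each block `{3j, 3j+1, 3j+2}` of the path. -/
def blockSwap (n : ℕ) (i : Fin n) : Fin n :=
  if h : (i : ℕ) % 3 = 0 ∧ (i : ℕ) + 2 < n then ⟨i + 2, h.2⟩
  else if (i : ℕ) % 3 = 2 then ⟨i - 2, by omega⟩ else i

lemma blockSwap_involutive (n : ℕ) : Function.Involutive (blockSwap n) := by
  intro i
  ext
  grind [blockSwap]

lemma cordDisc_pathG_le {n : ℕ} (hn : 1 ≤ n) {A : Finset (Fin n)}
    (hA : ∀ v, blockSwap n v ≠ v → (v ∈ A ↔ blockSwap n v ∉ A)) :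
    cordDisc (pathG n) A ≤ (n : ℤ) - 1 - 2 * (n / 3 : ℕ) := by
  classical
  have h := count_changes_bounds (natMem A) (n / 3) (n - 1) (by omega) (by
    intro j hj
    have h₂ : 3 * j + 2 < n := by omega
    have hs : blockSwap n ⟨3 * j, by omega⟩ = ⟨3 * j + 2, h₂⟩ := by
      simp [blockSwap, h₂]
    have key := hA ⟨3 * j, by omega⟩ (by rw [hs]; simp)
    rw [hs, ← natMem_val, ← natMem_val] at key
    simp only at key
    tauto)
  rw [← cutSize_pathG] at h
  rw [cordDisc, edgeCount_pathG, abs_le]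
  omega

/-- for `n ≥ 3`, `c_g(P_n) ≤ (n-3)/3` if `n ≡ 0 (mod 3)`,
`c_g(P_n) ≤ (n-1)/3` if `n ≡ 1 (mod 3)`, and `c_g(P_n) ≤ (n+1)/3` if
`n ≡ 2 (mod 3)` (the bounds are stated multiplied through by `3`). -/
theorem cg_path_upper_bound (n : ℕ) (hn : 3 ≤ n) :
    (n % 3 = 0 → 3 * cg (pathG n) ≤ (n : ℤ) - 3) ∧
    (n % 3 = 1 → 3 * cg (pathG n) ≤ (n : ℤ) - 1) ∧
    (n % 3 = 2 → 3 * cg (pathG n) ≤ (n : ℤ) + 1) := by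
  have h : cg (pathG n) ≤ (n : ℤ) - 1 - 2 * (n / 3 : ℕ) :=
    gameVal_univ_le_of_involutive (blockSwap_involutive n)
      (fun _ hA => cordDisc_pathG_le (by omega) hA) true
  omega
end

section
/- For every finite tree T of order n, in the cordiality game on T with Admirable moving first, Admirable has a strategy guaranteeing final discrepancy at most n/2; that is, c_g(T) ≤ n/2. -/
open Finset

variable {V : Type} [Fintype V] [DecidableEq V]

set_option linter.unusedSectionVars false

/-- The position with unselected vertices `R` and Admirable's vertices `A` respects the
pairing `f`: each pair is either entirely unselected, or shared between the two players. -/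
def PairingRespected (f : V → V) (R A : Finset V) : Prop :=
  Disjoint A R ∧ (∀ v ∈ R, f v ∈ R) ∧ ∀ v ∉ R, f v ≠ v → (v ∈ A ↔ f v ∉ A)

theorem PairingRespected.erase_fixed {f : V → V} (hf : Function.Involutive f) {R A : Finset V}
    (h : PairingRespected f R A) {v : V} (hfv : f v = v) :
    PairingRespected f (R.erase v) A := by
  obtain ⟨h1, h2, h3⟩ := h
  refine ⟨h1.mono_right (erase_subset _ _), fun u hu => ?_, fun u hu hfu => ?_⟩
  · simp only [mem_erase] at hu ⊢
    exact ⟨fun e => hu.1 (by rw [← hf u, e, hfv]), h2 u hu.2⟩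
  · refine h3 u (fun hR => hu ?_) hfu
    simp only [mem_erase]
    exact ⟨fun e => hfu (by rw [e, hfv]), hR⟩

theorem PairingRespected.insert_fixed {f : V → V} (hf : Function.Involutive f) {R A : Finset V}
    (h : PairingRespected f R A) {v : V} (hfv : f v = v) :
    PairingRespected f (R.erase v) (insert v A) := by
  obtain ⟨h1, h2, h3⟩ := h.erase_fixed hf hfv
  refine ⟨?_, h2, fun u hu hfu => ?_⟩
  · rw [disjoint_insert_left]
    exact ⟨notMem_erase _ _, h1⟩
  · have h4 : u ≠ v := fun e => hfu (by rw [e, hfv])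
    have h5 : f u ≠ v := fun e => h4 (by rw [← hf u, e, hfv])
    simpa [h4, h5] using h3 u hu hfu

theorem PairingRespected.split_pair {f : V → V} (hf : Function.Involutive f) {R A : Finset V}
    (h : PairingRespected f R A) {v : V} (hv : v ∈ R) (hfv : f v ≠ v) :
    PairingRespected f ((R.erase v).erase (f v)) (insert (f v) A) := by
  obtain ⟨h1, h2, h3⟩ := h
  have hA : ∀ u ∈ R, u ∉ A := fun u hu hA => disjoint_left.1 h1 hA hu
  refine ⟨?_, fun u hu => ?_, fun u hu hfu => ?_⟩
  · rw [disjoint_insert_left]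
    exact ⟨notMem_erase _ _,
      h1.mono_right ((erase_subset _ _).trans (erase_subset _ _))⟩
  · simp only [mem_erase] at hu ⊢
    exact ⟨fun e => hu.2.1 (hf.injective e), fun e => hu.1 (by rw [← e, hf u]), h2 u hu.2.2⟩
  · by_cases huv : u = v
    · subst huv
      simp [hfv.symm, hA u hv]
    by_cases hufv : u = f v
    · subst hufv
      simp [hf v, hfv.symm, hA v hv]
    · have h4 : f u ≠ f v := fun e => huv (hf.injective e)
      have h5 : u ∉ R := fun hR => hu (by simp [huv, hufv, hR])
      simpa [hufv, h4] using h3 u h5 hfu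

theorem gameVal_le_of_move {payoff : Finset V → ℤ} {p : ℕ} {R A : Finset V} {k : ℤ} {v : V}
    (hv : v ∈ R) (h : gameVal payoff p (R.erase v) (insert v A) false ≤ k) :
    gameVal payoff p R A true ≤ k := by
  rw [gameVal, dif_pos ⟨v, hv⟩, if_pos rfl]
  exact (inf'_le _ (mem_attach _ ⟨v, hv⟩)).trans h

theorem gameVal_le_of_forall_move {payoff : Finset V → ℤ} {R A : Finset V} {k : ℤ}
    (h0 : R = ∅ → payoff A ≤ k)
    (h : ∀ v ∈ R, gameVal payoff 0 (R.erase v) A true ≤ k) :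
    gameVal payoff 0 R A false ≤ k := by
  rw [gameVal]
  by_cases hR : R.Nonempty
  · simp only [hR, dif_pos, Bool.false_eq_true, if_false]
    exact sup'_le _ _ fun v _ => h v.1 v.2
  · rw [dif_neg hR]
    exact h0 (not_nonempty_iff_eq_empty.1 hR)

/-- If every outcome splitting all pairs of `f` has payoff at most `k`, then Admirable can
guarantee `k`: he answers in the pair opened by Impish, and on a free move he prefers
unpaired vertices. -/
theorem gameVal_le_of_pairing {f : V → V} (hf : Function.Involutive f)
    {payoff : Finset V → ℤ} {k : ℤ}
    (hk : ∀ S : Finset V, (∀ v, f v ≠ v → (v ∈ S ↔ f v ∉ S)) → payoff S ≤ k)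
    {R A : Finset V} (h : PairingRespected f R A) :
    gameVal payoff 0 R A true ≤ k := by
  have hend : ∀ A, PairingRespected f ∅ A → payoff A ≤ k := fun A h =>
    hk A fun v hv => h.2.2 v (notMem_empty v) hv
  suffices H : ∀ n : ℕ, ∀ R A : Finset V, PairingRespected f R A →
      (R.card = n → gameVal payoff 0 R A true ≤ k) ∧
      (R.card = n → gameVal payoff 0 R A false ≤ k) ∧
      ((∀ v ∈ R, f v ≠ v) → ∀ w ∉ R, w ∉ A → (insert w R).card = n →
        gameVal payoff 0 (insert w R) A false ≤ k) from (H R.card R A h).1 rfl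
  intro n
  induction n using Nat.strong_induction_on with
  | _ n ih =>
  intro R A hRA
  refine ⟨fun hc => ?_, fun hc => ?_, fun hfix w hwR hwA hc => ?_⟩
  · by_cases hfix : ∃ v ∈ R, f v = v
    · obtain ⟨v, hv, hfv⟩ := hfix
      refine gameVal_le_of_move hv ?_
      exact (ih _ (hc ▸ card_erase_lt_of_mem hv) _ _ (hRA.insert_fixed hf hfv)).2.1 rfl
    · push Not at hfix
      rcases R.eq_empty_or_nonempty with rfl | ⟨w, hw⟩
      · rw [gameVal, dif_neg (by simp)]
        exact hend A hRA
      · have hv := hRA.2.1 w hw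
        refine gameVal_le_of_move hv ?_
        have hw' : w ∈ R.erase (f w) := mem_erase.2 ⟨(hfix w hw).symm, hw⟩
        have hG := hRA.split_pair hf hw (hfix w hw)
        rw [erase_right_comm] at hG
        have := (ih _ (hc ▸ card_erase_lt_of_mem hv) _ _ hG).2.2
          (fun u hu => hfix u (mem_of_mem_erase (mem_of_mem_erase hu))) w (notMem_erase _ _)
          (by
            rw [mem_insert, not_or]
            exact ⟨(hfix w hw).symm, fun hA => disjoint_left.1 hRA.1 hA hw⟩)
        rw [insert_erase hw'] at this
        exact this rfl
  · refine gameVal_le_of_forall_move (fun h0 => hend A (h0 ▸ hRA)) fun v hv => ?_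
    have hlt := card_erase_lt_of_mem hv
    by_cases hfv : f v = v
    · exact (ih _ (hc ▸ hlt) _ _ (hRA.erase_fixed hf hfv)).1 rfl
    · have hw : f v ∈ R.erase v := mem_erase.2 ⟨hfv, hRA.2.1 v hv⟩
      refine gameVal_le_of_move hw ?_
      exact (ih _ (hc ▸ (card_erase_lt_of_mem hw).trans hlt) _ _
        (hRA.split_pair hf hv hfv)).2.1 rfl
  · refine gameVal_le_of_forall_move (fun h0 => (insert_ne_empty _ _ h0).elim) fun v hv => ?_
    have hlt := card_erase_lt_of_mem hv
    by_cases hvw : v = w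
    · subst hvw
      rw [erase_insert hwR] at hlt ⊢
      exact (ih _ (hc ▸ hlt) _ _ hRA).1 rfl
    · have hvR : v ∈ R := (mem_insert.1 hv).resolve_left hvw
      have hfvR := hRA.2.1 v hvR
      have hwf : w ≠ f v := fun e => hwR (e ▸ hfvR)
      have hw : f v ∈ (insert w R).erase v :=
        mem_erase.2 ⟨hfix v hvR, mem_insert_of_mem hfvR⟩
      have hlt' := (card_erase_lt_of_mem hw).trans hlt
      refine gameVal_le_of_move hw ?_
      rw [erase_insert_of_ne (Ne.symm hvw), erase_insert_of_ne hwf] at hlt' ⊢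
      exact (ih _ (hc ▸ hlt') _ _ (hRA.split_pair hf hvR (hfix v hvR))).2.2
        (fun u hu => hfix u (mem_of_mem_erase (mem_of_mem_erase hu))) w
        (fun h => hwR (mem_of_mem_erase (mem_of_mem_erase h)))
        (by simp [hwf, hwA]) rfl

/-- The contribution to `e₀ - e₁` of the edge from `u` to its parent, `0` for the root `r`. -/
def parentTerm (r : V) (par : V → V) (x : V → ℤ) (u : V) : ℤ :=
  if u = r then 0 else x u * x (par u)

theorem abs_parentTerm_le {r : V} {par : V → V} {x : V → ℤ} (hx : ∀ v, x v = 1 ∨ x v = -1)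
    (u : V) : |parentTerm r par x u| ≤ 1 := by
  unfold parentTerm
  split_ifs
  · simp
  · rcases hx u with h | h <;> rcases hx (par u) with h' | h' <;> simp [h, h']

/-- A pairing on `X \ R` with small discrepancy extends to `X` by one (possibly trivial) pair
`a, b` of `R`, if that pair makes the discrepancy of `R` small. -/
theorem exists_pairing_of_sdiff {r : V} {par : V → V} {X R : Finset V} (hR : R ⊆ X) {a b : V}
    (ha : a ∈ R) (hb : b ∈ R)
    (hsum : ∀ x : V → ℤ, (∀ v, x v = 1 ∨ x v = -1) → (a ≠ b → x b = -x a) →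
      2 * |∑ u ∈ R, parentTerm r par x u| ≤ R.card)
    (h : ∃ f : V → V, Function.Involutive f ∧ (∀ v ∉ X \ R, f v = v) ∧
      ∀ x : V → ℤ, (∀ v, x v = 1 ∨ x v = -1) → (∀ v, f v ≠ v → x (f v) = -x v) →
        2 * |∑ u ∈ X \ R, parentTerm r par x u| ≤ (X \ R).card) :
    ∃ f : V → V, Function.Involutive f ∧ (∀ v ∉ X, f v = v) ∧
      ∀ x : V → ℤ, (∀ v, x v = 1 ∨ x v = -1) → (∀ v, f v ≠ v → x (f v) = -x v) →
        2 * |∑ u ∈ X, parentTerm r par x u| ≤ X.card := by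
  obtain ⟨f, hf, hfix, hfs⟩ := h
  have hfa : f a = a := hfix a (by simp [ha])
  have hfb : f b = b := hfix b (by simp [hb])
  have hswap : ∀ v, f v ≠ v → Equiv.swap a b (f v) = f v := fun v hv =>
    Equiv.swap_apply_of_ne_of_ne
      (fun e => hv (by rw [e]; exact (hfa.symm.trans (by rw [← e, hf v]))))
      (fun e => hv (by rw [e]; exact (hfb.symm.trans (by rw [← e, hf v]))))
  have hcomm : ∀ v, f (Equiv.swap a b v) = Equiv.swap a b (f v) := by
    intro v
    by_cases hva : v = a
    · subst hva; simp [hfa, hfb]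
    by_cases hvb : v = b
    · subst hvb; simp [hfa, hfb]
    rw [Equiv.swap_apply_of_ne_of_ne hva hvb]
    by_cases hv : f v = v
    · rw [hv, Equiv.swap_apply_of_ne_of_ne hva hvb]
    · exact (hswap v hv).symm
  refine ⟨fun v => Equiv.swap a b (f v), fun v => ?_, fun v hv => ?_, fun x hx hsplit => ?_⟩
  · simp [hcomm, hf v]
  · have hva : v ≠ a := fun e => hv (e ▸ hR ha)
    have hvb : v ≠ b := fun e => hv (e ▸ hR hb)
    show Equiv.swap a b (f v) = v
    rw [hfix v (fun h => hv (mem_sdiff.1 h).1), Equiv.swap_apply_of_ne_of_ne hva hvb]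
  · have h1 := hfs x hx fun v hv => by
      have := hsplit v
      simp only [hswap v hv] at this
      exact this hv
    have h2 := hsum x hx fun hab => by
      have := hsplit a
      simp only [hfa, Equiv.swap_apply_left] at this
      exact this hab.symm
    have h3 := card_sdiff_add_card_eq_card hR
    rw [← sum_sdiff hR]
    have h4 := abs_add_le (∑ u ∈ X \ R, parentTerm r par x u) (∑ u ∈ R, parentTerm r par x u)
    have h5 : ((X \ R).card : ℤ) + R.card = X.card := by exact_mod_cast h3
    linarith

/-- In a finite rooted tree there is a pairing of vertices such that every splitting of the
pairs has small discrepancy. The set `X` is closed under taking parents. -/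
theorem exists_pairing {r : V} {par : V → V} {d : V → ℕ}
    (hd : ∀ u, u ≠ r → d u = d (par u) + 1) (X : Finset V)
    (hX : ∀ u ∈ X, u ≠ r → par u ∈ X) :
    ∃ f : V → V, Function.Involutive f ∧ (∀ v ∉ X, f v = v) ∧
      ∀ x : V → ℤ, (∀ v, x v = 1 ∨ x v = -1) → (∀ v, f v ≠ v → x (f v) = -x v) →
        2 * |∑ u ∈ X, parentTerm r par x u| ≤ X.card := by
  induction X using Finset.strongInduction with
  | _ X ih =>
  rcases X.eq_empty_or_nonempty with rfl | hne
  · exact ⟨id, fun _ => rfl, fun _ _ => rfl, by simp⟩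
  obtain ⟨v, hv, hmax⟩ := X.exists_max_image d hne
  have step : ∀ R : Finset V, R ⊆ X → (∀ u ∈ X, u ≠ r → par u ∈ R → u ∈ R) →
      ∀ a ∈ R, ∀ b ∈ R, (∀ x : V → ℤ, (∀ v, x v = 1 ∨ x v = -1) → (a ≠ b → x b = -x a) →
      2 * |∑ u ∈ R, parentTerm r par x u| ≤ R.card) →
      ∃ f : V → V, Function.Involutive f ∧ (∀ v ∉ X, f v = v) ∧
      ∀ x : V → ℤ, (∀ v, x v = 1 ∨ x v = -1) → (∀ v, f v ≠ v → x (f v) = -x v) →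
        2 * |∑ u ∈ X, parentTerm r par x u| ≤ X.card := by
    intro R hR hcl a ha b hb hsum
    refine exists_pairing_of_sdiff hR ha hb hsum (ih _ (sdiff_ssubset hR ⟨a, ha⟩) ?_)
    intro u hu hur
    rw [mem_sdiff] at hu ⊢
    exact ⟨hX u hu.1 hur, fun h => hu.2 (hcl u hu.1 hur h)⟩
  have leaf : ∀ w, d v ≤ d w → ∀ u ∈ X, u ≠ r → par u ≠ w := by
    intro w hw u hu hur e
    have := hd u hur
    have := hmax u hu
    subst e
    omega
  have siblings : ∀ a ∈ X, ∀ b ∈ X, a ≠ b → a ≠ r → b ≠ r → par a = par b → d v ≤ d a →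
      ∃ f : V → V, Function.Involutive f ∧ (∀ v ∉ X, f v = v) ∧
      ∀ x : V → ℤ, (∀ v, x v = 1 ∨ x v = -1) → (∀ v, f v ≠ v → x (f v) = -x v) →
        2 * |∑ u ∈ X, parentTerm r par x u| ≤ X.card := by
    intro a ha b hb hab har hbr hpar hda
    have hdb : d v ≤ d b := by rw [hd b hbr, ← hpar, ← hd a har]; exact hda
    refine step {a, b} (by simp [insert_subset_iff, ha, hb]) (fun u hu hur hp => ?_)
      a (by simp) b (by simp) fun x hx hxab => ?_
    · simp only [mem_insert, mem_singleton] at hp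
      exact absurd hp (not_or.2 ⟨leaf a hda u hu hur, leaf b hdb u hu hur⟩)
    · rw [sum_pair hab]
      simp [parentTerm, har, hbr, hpar, hxab hab]
  by_cases hvr : v = r
  · refine step {v} (by simpa using hv) (fun u hu hur hp => ?_) v (by simp) v (by simp)
      fun x hx _ => ?_
    · exact absurd (mem_singleton.1 hp) (leaf v le_rfl u hu hur)
    · simp [parentTerm, hvr]
  have hdv := hd v hvr
  have hpX := hX v hv hvr
  by_cases h1 : ∃ w ∈ X, w ≠ r ∧ w ≠ v ∧ par w = par v
  · obtain ⟨w, hw, hwr, hwv, hp⟩ := h1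
    exact siblings v hv w hw hwv.symm hvr hwr hp.symm le_rfl
  have only_v : ∀ u ∈ X, u ≠ r → par u = par v → u = v := fun u hu hur hp => by
    by_contra hne
    exact h1 ⟨u, hu, hur, hne, hp⟩
  have hvp : v ≠ par v := fun e => by rw [← e] at hdv; omega
  obtain ⟨p, hp⟩ : ∃ p, p = par v := ⟨_, rfl⟩
  rw [← hp] at hdv hpX only_v hvp
  by_cases hpr : p = r
  · refine step {v, p} (by simp [insert_subset_iff, hv, hpX]) (fun u hu hur hpu => ?_)
      v (by simp) v (by simp) fun x hx _ => ?_
    · simp only [mem_insert, mem_singleton] at hpu ⊢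
      exact Or.inl (only_v u hu hur (hpu.resolve_left (leaf v le_rfl u hu hur)))
    · rw [card_pair hvp, sum_pair hvp]
      have := abs_parentTerm_le (r := r) (par := par) hx v
      have h0 : parentTerm r par x p = 0 := by simp [parentTerm, hpr]
      rw [h0, add_zero]
      push_cast
      linarith
  have hdp := hd p hpr
  have hgX := hX p hpX hpr
  obtain ⟨g, hg⟩ : ∃ g, g = par p := ⟨_, rfl⟩
  rw [← hg] at hdp hgX
  by_cases h2 : ∃ q ∈ X, q ≠ r ∧ q ≠ p ∧ par q = g
  · obtain ⟨q, hqX, hqr, hqp, hq⟩ := h2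
    have hdq := hd q hqr
    rw [hq] at hdq
    have hqv : q ≠ v := fun e => by subst e; omega
    by_cases h3 : ∃ c ∈ X, c ≠ r ∧ par c = q
    · obtain ⟨c, hcX, hcr, hc⟩ := h3
      have hdc := hd c hcr
      rw [hc] at hdc
      by_cases h4 : ∃ e ∈ X, e ≠ r ∧ e ≠ c ∧ par e = q
      · obtain ⟨e, heX, her, hec, he⟩ := h4
        exact siblings c hcX e heX hec.symm hcr her (hc.trans he.symm) (by omega)
      · have only_c : ∀ u ∈ X, u ≠ r → par u = q → u = c := fun u hu hur hp => by
          by_contra hne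
          exact h4 ⟨u, hu, hur, hne, hp⟩
        have hcv : c ≠ v := fun e => hqp (by rw [← hc, e, hp])
        have hcp : c ≠ p := fun e => by subst e; omega
        have hcq : c ≠ q := fun e => by subst e; omega
        refine step {v, c, p, q} (by simp [insert_subset_iff, hv, hcX, hpX, hqX])
          (fun u hu hur hpu => ?_) p (by simp) q (by simp) fun x hx hxpq => ?_
        · simp only [mem_insert, mem_singleton] at hpu ⊢
          rcases hpu with h | h | h | h
          · exact absurd h (leaf v le_rfl u hu hur)
          · exact absurd h (leaf c (by omega) u hu hur)
          · exact Or.inl (only_v u hu hur h)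
          · exact Or.inr (Or.inl (only_c u hu hur h))
        · have hcard : ({v, c, p, q} : Finset V).card = 4 := by
            simp [hcv.symm, hvp, hqv.symm, hcp, hcq, hqp.symm]
          rw [hcard, sum_insert (by simp [hcv.symm, hvp, hqv.symm]),
            sum_insert (by simp [hcp, hcq]), sum_pair hqp.symm]
          have h5 : parentTerm r par x p + parentTerm r par x q = 0 := by
            simp [parentTerm, hpr, hqr, hq, ← hg, hxpq hqp.symm]
          have h6 := abs_parentTerm_le (r := r) (par := par) hx v
          have h7 := abs_parentTerm_le (r := r) (par := par) hx c
          rw [h5, add_zero]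
          have h8 := abs_add_le (parentTerm r par x v) (parentTerm r par x c)
          push_cast
          linarith
    · have q_leaf : ∀ u ∈ X, u ≠ r → par u ≠ q := fun u hu hur hp => h3 ⟨u, hu, hur, hp⟩
      refine step {v, p, q} (by simp [insert_subset_iff, hv, hpX, hqX])
        (fun u hu hur hpu => ?_) p (by simp) q (by simp) fun x hx hxpq => ?_
      · simp only [mem_insert, mem_singleton] at hpu ⊢
        rcases hpu with h | h | h
        · exact absurd h (leaf v le_rfl u hu hur)
        · exact Or.inl (only_v u hu hur h)
        · exact absurd h (q_leaf u hu hur)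
      · have hcard : ({v, p, q} : Finset V).card = 3 := by simp [hvp, hqv.symm, hqp.symm]
        rw [hcard, sum_insert (by simp [hvp, hqv.symm]), sum_pair hqp.symm]
        have h5 : parentTerm r par x p + parentTerm r par x q = 0 := by
          simp [parentTerm, hpr, hqr, hq, ← hg, hxpq hqp.symm]
        have h6 := abs_parentTerm_le (r := r) (par := par) hx v
        rw [h5, add_zero]
        push_cast
        linarith
  · have only_p : ∀ u ∈ X, u ≠ r → par u = g → u = p := fun u hu hur hp => by
      by_contra hne
      exact h2 ⟨u, hu, hur, hne, hp⟩
    have hvg : v ≠ g := fun e => by subst e; omega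
    have hpg : p ≠ g := fun e => by rw [← e] at hdp; omega
    refine step {v, p, g} (by simp [insert_subset_iff, hv, hpX, hgX])
      (fun u hu hur hpu => ?_) v (by simp) g (by simp) fun x hx hxvg => ?_
    · simp only [mem_insert, mem_singleton] at hpu ⊢
      rcases hpu with h | h | h
      · exact absurd h (leaf v le_rfl u hu hur)
      · exact Or.inl (only_v u hu hur h)
      · exact Or.inr (Or.inl (only_p u hu hur h))
    · have hcard : ({v, p, g} : Finset V).card = 3 := by simp [hvp, hvg, hpg]
      rw [hcard, sum_insert (by simp [hvp, hvg]), sum_pair hpg, ← add_assoc]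
      have h5 : parentTerm r par x v + parentTerm r par x p = 0 := by
        simp only [parentTerm, hvr, hpr, if_false, ← hp, ← hg, hxvg hvg]
        ring
      have h6 := abs_parentTerm_le (r := r) (par := par) hx g
      rw [h5, zero_add]
      push_cast
      linarith

theorem SimpleGraph.Connected.exists_parent {T : SimpleGraph V} (hT : T.Connected) (r : V) :
    ∃ par : V → V, ∀ u, u ≠ r → T.Adj u (par u) ∧ T.dist u r = T.dist (par u) r + 1 := by
  have h : ∀ u, ∃ w, u ≠ r → T.Adj u w ∧ T.dist u r = T.dist w r + 1 := by
    intro u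
    by_cases hu : u = r
    · exact ⟨u, fun h => absurd hu h⟩
    obtain ⟨p, hp⟩ := hT.exists_walk_length_eq_dist u r
    cases p with
    | nil => exact absurd rfl hu
    | @cons _ w _ hadj q =>
      refine ⟨w, fun _ => ⟨hadj, ?_⟩⟩
      have h1 := SimpleGraph.dist_le q
      have h2 := hT.dist_triangle (u := u) (v := w) (w := r)
      rw [SimpleGraph.dist_eq_one_iff_adj.2 hadj] at h2
      rw [SimpleGraph.Walk.length_cons] at hp
      omega
  choose par hpar using h
  exact ⟨par, hpar⟩

/-- In a rooted tree, the signed discrepancy is a sum over the non-root vertices. -/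
theorem balDisc_eq_neg_sum_parentTerm {T : SimpleGraph V} [DecidableRel T.Adj] (hT : T.IsTree)
    {r : V} {par : V → V}
    (hpar : ∀ u, u ≠ r → T.Adj u (par u) ∧ T.dist u r = T.dist (par u) r + 1)
    (S : Finset V) :
    balDisc T S = -∑ u, parentTerm r par (fun v => if v ∈ S then 1 else -1) u := by
  have hinj : Set.InjOn (fun u => s(u, par u)) (univ.erase r : Finset V) := by
    intro u hu w hw he
    have hu' := hpar u (by simpa using hu)
    have hw' := hpar w (by simpa using hw)
    rcases Sym2.eq_iff.1 he with h | h
    · exact h.1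
    · have h1 := hu'.2
      have h2 := hw'.2
      rw [h.2] at h1
      rw [← h.1] at h2
      omega
  have hcard : (univ.erase r).card = T.edgeFinset.card := by
    have := hT.card_edgeFinset
    rw [card_erase_of_mem (mem_univ _), card_univ]
    omega
  have hedges : (univ.erase r).image (fun u => s(u, par u)) = T.edgeFinset := by
    refine eq_of_subset_of_card_le (fun e he => ?_) ?_
    · obtain ⟨u, hu, rfl⟩ := mem_image.1 he
      simpa using (hpar u (by simpa using hu)).1
    · rw [card_image_of_injOn hinj, hcard]
  have hcut : cutSize T S =
      ((univ.erase r).filter fun u => ¬(u ∈ S ↔ par u ∈ S)).card := by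
    unfold cutSize
    rw [← card_image_of_injOn (f := fun p : V × V => s(p.1, p.2)),
      ← card_image_of_injOn (hinj.mono (coe_subset.2 (filter_subset _ _)))]
    · congr 1
      ext e
      simp only [mem_image, mem_filter, mem_erase, mem_univ, mem_product, true_and, and_true,
        Prod.exists]
      constructor
      · rintro ⟨a, b, ⟨hab, ha, hb⟩, rfl⟩
        have : s(a, b) ∈ (univ.erase r).image (fun u => s(u, par u)) := by
          rw [hedges]; simpa using hab
        obtain ⟨u, hu, he⟩ := mem_image.1 this
        refine ⟨u, ⟨by simpa using hu, ?_⟩, he⟩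
        rcases Sym2.eq_iff.1 he with ⟨h1, h2⟩ | ⟨h1, h2⟩ <;> rw [h2, h1] <;> tauto
      · rintro ⟨u, ⟨hu, hS⟩, rfl⟩
        have hadj := (hpar u hu).1
        by_cases huS : u ∈ S
        · exact ⟨u, par u, ⟨hadj, huS, by tauto⟩, rfl⟩
        · exact ⟨par u, u, ⟨hadj.symm, by tauto, huS⟩, Sym2.eq_swap⟩
    · rintro ⟨a, b⟩ hab ⟨a', b'⟩ hab' he
      simp only [coe_filter, Set.mem_ofPred_eq] at hab hab'
      rcases Sym2.eq_iff.1 he with ⟨h1, h2⟩ | ⟨h1, h2⟩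
      · exact Prod.ext h1 h2
      · simp only at h1 h2
        exact absurd (h1 ▸ hab.2.2.1) hab'.2.2.2
  rw [balDisc, edgeCount, hcut, ← hcard, ← add_sum_erase univ _ (mem_univ r), card_filter,
    card_eq_sum_ones]
  push_cast
  rw [mul_sum, ← sum_sub_distrib, neg_add, ← sum_neg_distrib]
  have h0 : parentTerm r par (fun v => if v ∈ S then 1 else -1) r = 0 := by simp [parentTerm]
  rw [h0, neg_zero, zero_add]
  refine sum_congr rfl fun u hu => ?_
  have hur : u ≠ r := by simpa using hu
  rw [parentTerm, if_neg hur]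
  by_cases h1 : u ∈ S <;> by_cases h2 : par u ∈ S <;> simp [h1, h2]

/-- for every finite tree `T` of order `n`, `c_g(T) ≤ n/2`
(stated multiplied through by `2`). -/
theorem cg_tree_upper_bound (T : SimpleGraph V) [DecidableRel T.Adj]
    (hT : T.IsTree) : 2 * cg T ≤ (Fintype.card V : ℤ) := by
  obtain ⟨r⟩ := hT.connected.nonempty
  obtain ⟨par, hpar⟩ := hT.connected.exists_parent r
  obtain ⟨f, hf, -, hsum⟩ := exists_pairing (r := r) (par := par) (d := fun u => T.dist u r)
    (fun u hu => (hpar u hu).2) univ (fun _ _ _ => mem_univ _)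
  have hk : cg T ≤ (Fintype.card V : ℤ) / 2 := by
    refine gameVal_le_of_pairing hf (fun S hS => ?_) ⟨by simp, by simp, by simp⟩
    have h := hsum (fun v => if v ∈ S then 1 else -1) (fun v => by by_cases v ∈ S <;> simp [*])
      (fun v hv => by
        have := hS v hv
        by_cases h1 : v ∈ S <;> by_cases h2 : f v ∈ S <;> simp_all)
    rw [← abs_neg, ← balDisc_eq_neg_sum_parentTerm hT hpar S, card_univ] at h
    change |balDisc T S| ≤ _
    omega
  omega
end

section
/- For every integer n ≥ 2, in the balance game on the path P_n with Admirable moving first, Impish has a strategy guaranteeing that at the end of play the number of edges labeled 1 is at least the number of edges labeled 0; hence b_g(P_n) ≥ 0. -/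
open Finset

variable {V : Type} [Fintype V] [DecidableEq V]

/-- The position reached in a game where Impish answers along the involution `σ`: every
two-element orbit that is used up is split between the players, the used vertex of a half-used
orbit belongs to Impish, and at most one remaining vertex lacks a remaining partner. -/
structure IsPaired {α : Type} (σ : α → α) (rem A : Finset α) : Prop where
  notMem_rem : ∀ v ∈ A, v ∉ rem
  split : ∀ v, v ∉ rem → σ v ≠ v → σ v ∉ rem → (v ∈ A ↔ σ v ∉ A)
  half_used : ∀ v, v ∉ rem → σ v ∈ rem → v ∉ A
  unique_single : ∀ v ∈ rem, ∀ w ∈ rem, (σ v ∉ rem ∨ σ v = v) → (σ w ∉ rem ∨ σ w = w) → v = w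

/-- When Admirable takes `x` and some vertex remains, Impish has an answer `y` restoring
`IsPaired`. -/
lemma IsPaired.exists_answer {α : Type} [DecidableEq α] {σ : α → α}
    (hσ : Function.Involutive σ) {rem A : Finset α}
    (h : IsPaired σ rem A) {x : α} (hx : x ∈ rem) (hne : (rem.erase x).Nonempty) :
    ∃ y ∈ rem.erase x, IsPaired σ ((rem.erase x).erase y) (insert x A) := by
  obtain ⟨h1, h2, h3, h4⟩ := h
  have hσ' : ∀ v, σ (σ v) = v := hσ
  by_cases hs : σ x ∉ rem ∨ σ x = x
  · obtain ⟨y, hy⟩ := hne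
    refine ⟨y, hy, ?_, ?_, ?_, ?_⟩ <;> grind
  · refine ⟨σ x, by grind, ?_, ?_, ?_, ?_⟩ <;> grind

/-- If Admirable takes the last vertex, all two-element orbits end up split. -/
lemma IsPaired.split_of_erase_eq_empty {α : Type} [DecidableEq α] {σ : α → α}
    (hσ : Function.Involutive σ) {rem A : Finset α} (h : IsPaired σ rem A) {x : α} (hx : x ∈ rem)
    (he : rem.erase x = ∅)
    (v : α) (hv : σ v ≠ v) : v ∈ insert x A ↔ σ v ∉ insert x A := by
  obtain ⟨h1, h2, h3, h4⟩ := h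
  have hσ' : ∀ v, σ (σ v) = v := hσ
  have hr : ∀ w, w ∈ rem ↔ w = x := by
    intro w
    have : w ∉ rem.erase x := by simp [he]
    grind
  grind

/-- Impish's pairing strategy: if splitting all two-element orbits of an involution forces
payoff at least `k`, then Impish can guarantee payoff at least `k` from every paired
position with Admirable to move. -/
theorem le_gameVal_of_isPaired {α : Type} [DecidableEq α] {payoff : Finset α → ℤ} {k : ℤ}
    {σ : α → α} (hσ : Function.Involutive σ)
    (hpay : ∀ A : Finset α, (∀ v, σ v ≠ v → (v ∈ A ↔ σ v ∉ A)) → k ≤ payoff A)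
    (rem A : Finset α) (h : IsPaired σ rem A) : k ≤ gameVal payoff 0 rem A true := by
  induction hm : rem.card using Nat.strong_induction_on generalizing rem A with
  | _ m ih =>
  by_cases hrem : rem.Nonempty
  · rw [gameVal, dif_pos hrem, if_pos rfl]
    refine Finset.le_inf' _ _ fun x _ => ?_
    by_cases hne : (rem.erase x.1).Nonempty
    · rw [gameVal, dif_pos hne, if_neg Bool.false_ne_true, dif_pos rfl]
      obtain ⟨y, hy, hp⟩ := h.exists_answer hσ x.2 hne
      refine (ih _ ?_ _ _ hp rfl).trans
        (Finset.le_sup' (f := fun v : {v // v ∈ rem.erase x.1} =>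
          gameVal payoff 0 ((rem.erase x.1).erase v.1) (insert x.1 A) true)
          (Finset.mem_attach _ ⟨y, hy⟩))
      have h1 := Finset.card_erase_lt_of_mem hy
      have h2 := Finset.card_erase_lt_of_mem x.2
      omega
    · rw [gameVal, dif_neg hne]
      exact hpay _ fun v hv =>
        h.split_of_erase_eq_empty hσ x.2 (Finset.not_nonempty_iff_eq_empty.mp hne) v hv
  · rw [gameVal, dif_neg hrem]
    obtain rfl := Finset.not_nonempty_iff_eq_empty.mp hrem
    exact hpay _ fun v hv => h.split v (by simp) hv (by simp)

/-- The involution of `Fin n` swapping `2i` and `2i + 1` whenever both are less than `n`. -/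
def pathPartner (n : ℕ) (i : Fin n) : Fin n :=
  if (i : ℕ) % 2 = 1 then ⟨i - 1, by omega⟩
  else if h : (i : ℕ) + 1 < n then ⟨i + 1, h⟩ else i

lemma pathPartner_involutive (n : ℕ) : Function.Involutive (pathPartner n) := by
  intro i
  ext
  grind [pathPartner]

lemma pathG_adj_iff {n : ℕ} (i j : Fin n) :
    (pathG n).Adj i j ↔ (i : ℕ) + 1 = j ∨ (j : ℕ) + 1 = i := by
  rw [pathG, SimpleGraph.fromRel_adj, and_iff_right_iff_imp]
  rintro h rfl
  omega

lemma edgeCount_pathG_le (n : ℕ) : edgeCount (pathG n) ≤ n - 1 := by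
  have hsub : (pathG n).edgeFinset ⊆ (univ : Finset (Fin (n - 1))).image
      fun i : Fin (n - 1) => s((⟨i, by omega⟩ : Fin n), ⟨i + 1, by omega⟩) := by
    intro e
    induction e with | _ a b =>
    rw [SimpleGraph.mem_edgeFinset, SimpleGraph.mem_edgeSet, pathG_adj_iff, Finset.mem_image]
    rintro (h | h)
    · exact ⟨⟨a, by omega⟩, mem_univ _, by simp [h]⟩
    · exact ⟨⟨b, by omega⟩, mem_univ _, by simp [h, Sym2.eq_swap]⟩
  exact (Finset.card_le_card hsub).trans (Finset.card_image_le.trans (by simp))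

lemma half_le_cutSize_pathG {n : ℕ} {A : Finset (Fin n)}
    (hA : ∀ v, pathPartner n v ≠ v → (v ∈ A ↔ pathPartner n v ∉ A)) :
    n / 2 ≤ cutSize (pathG n) A := by
  have hsplit : ∀ k (hk : k < n / 2),
      ((⟨2 * k, by omega⟩ : Fin n) ∈ A ↔ (⟨2 * k + 1, by omega⟩ : Fin n) ∉ A) := by
    intro k hk
    have hp : pathPartner n ⟨2 * k, by omega⟩ = ⟨2 * k + 1, by omega⟩ := by
      grind [pathPartner]
    simpa [hp] using hA ⟨2 * k, by omega⟩ (by simp [hp])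
  let f : Fin (n / 2) → Fin n × Fin n := fun k =>
    if (⟨2 * k, by omega⟩ : Fin n) ∈ A then (⟨2 * k, by omega⟩, ⟨2 * k + 1, by omega⟩)
    else (⟨2 * k + 1, by omega⟩, ⟨2 * k, by omega⟩)
  have hcard := Finset.card_le_card_of_injOn (s := (univ : Finset (Fin (n / 2))))
    (t := (univ ×ˢ univ).filter
      fun p : Fin n × Fin n => (pathG n).Adj p.1 p.2 ∧ p.1 ∈ A ∧ p.2 ∉ A) f
    (fun k _ => by
      have := hsplit k k.2
      by_cases hk : (⟨2 * k, by omega⟩ : Fin n) ∈ A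
      · simp_all [f, pathG_adj_iff]
      · simp_all [f, pathG_adj_iff])
    (fun a _ b _ hab => by
      have h1 := congrArg (fun p : Fin n × Fin n => (p.1 : ℕ)) hab
      ext
      simp only [f] at h1
      split_ifs at h1 <;> simp at h1 <;> omega)
  simpa [cutSize] using hcard

/-- for every `n ≥ 2`, the game balance number of `P_n` is
nonnegative. -/
theorem bg_path_nonneg (n : ℕ) (hn : 2 ≤ n) : 0 ≤ bg (pathG n) := by
  refine le_gameVal_of_isPaired (pathPartner_involutive n) (fun A hA => ?_) _ _
    ⟨by simp, by simp, by simp, ?_⟩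
  · have h1 := half_le_cutSize_pathG hA
    have h2 := edgeCount_pathG_le n
    unfold balDisc
    omega
  · intro v _ w _ hv hw
    ext
    grind [pathPartner]
end

section
/- Every finite tree T containing a vertex of degree at least 3 contains a vertex u with deg_T(u) ≥ 3 such that at least deg_T(u) − 1 of the components of T − u are paths, each of which is joined to u by an edge from u to an end-vertex of that path; in particular, at least two components of T − u are such pendant paths and at most one component of T − u is not of this form. -/
open Finset

variable {V : Type} [Fintype V] [DecidableEq V]

/-- The connected component `c` of `T - u` is a pendant path at `u`: the
induced subgraph on `c` is a path (connected, acyclic, and with all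
degrees at most `2`), and every vertex of `c` adjacent to `u` in `T` (there
is exactly one such vertex) is an end-vertex of that path (has at most one
neighbor within the component). -/
def IsPendantPathComponent (T : SimpleGraph V) (u : V)
    (c : (T.induce {x | x ≠ u}).ConnectedComponent) : Prop :=
  ((T.induce {x | x ≠ u}).induce c.supp).Connected ∧
  ((T.induce {x | x ≠ u}).induce c.supp).IsAcyclic ∧
  (∀ w, (((T.induce {x | x ≠ u}).induce c.supp).neighborSet w).ncard ≤ 2) ∧
  (∀ w : c.supp, T.Adj u w.1.1 →
    (((T.induce {x | x ≠ u}).induce c.supp).neighborSet w).ncard ≤ 1)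

/-- In an acyclic graph, two neighbors of `u` joined by a walk avoiding `u` coincide. -/
theorem eq_of_adj_of_reachable_induce_ne {V : Type} {T : SimpleGraph V} (hT : T.IsAcyclic)
    {u : V} {a b : {x | x ≠ u}} (ha : T.Adj u a.1) (hb : T.Adj u b.1)
    (hab : (T.induce {x | x ≠ u}).Reachable a b) : a = b := by
  by_contra hne
  obtain ⟨p, hp⟩ := hab.exists_isPath
  let f := (SimpleGraph.Embedding.induce (G := T) {x | x ≠ u}).toHom
  have hp' : (p.map f).IsPath :=
    hp.map Subtype.val_injective
  let q : T.Walk a.1 b.1 := .cons ha.symm (.cons hb .nil)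
  have hq : q.IsPath := by
    have hval : a.1 ≠ b.1 := fun h => hne (Subtype.ext h)
    simp [q, SimpleGraph.Walk.cons_isPath_iff, ha.ne', hb.ne, hval]
  have hpq : p.map f = q :=
    congrArg Subtype.val (hT.subsingleton_path a.1 b.1 |>.elim ⟨p.map f, hp'⟩ ⟨q, hq⟩)
  have hu : u ∈ (p.map f).support := by
    rw [hpq]
    exact List.mem_cons_of_mem _ List.mem_cons_self
  rw [SimpleGraph.Walk.support_map, List.mem_map] at hu
  obtain ⟨x, -, hx⟩ := hu
  exact x.2 hx

/-- If `T` is acyclic, `T - u` has at least `deg u` components. -/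
theorem degree_le_card_connectedComponent_induce_ne {V : Type} [Fintype V]
    {T : SimpleGraph V} [DecidableRel T.Adj] (hT : T.IsAcyclic) (u : V) :
    T.degree u ≤ Nat.card (T.induce {x | x ≠ u}).ConnectedComponent := by
  rw [← SimpleGraph.card_neighborSet_eq_degree, ← Nat.card_eq_fintype_card]
  refine Nat.card_le_card_of_injective
    (fun a : T.neighborSet u => (T.induce {x | x ≠ u}).connectedComponentMk
      ⟨a.1, ((T.mem_neighborSet u a.1).1 a.2).ne'⟩) fun a b hab => ?_
  have h := eq_of_adj_of_reachable_induce_ne hT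
    ((T.mem_neighborSet u a.1).1 a.2) ((T.mem_neighborSet u b.1).1 b.2)
    (SimpleGraph.ConnectedComponent.exact hab)
  exact Subtype.ext (congrArg (fun x : {x | x ≠ u} => x.1) h)

/-- A component of `T - u` missing `r` is farther from `r` than `u` is. -/
theorem dist_lt_dist_of_mem_supp {V : Type} [DecidableEq V] {T : SimpleGraph V}
    (hT : T.Connected) {u r : V} {c : (T.induce {x | x ≠ u}).ConnectedComponent}
    (hr : ∀ x ∈ c.supp, x.1 ≠ r) {w : {x | x ≠ u}} (hw : w ∈ c.supp) :
    T.dist r u < T.dist r w := by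
  obtain ⟨p, hp⟩ := hT.exists_walk_length_eq_dist r w.1
  have hu : u ∈ p.support := by
    by_contra hu
    have hs : ∀ x ∈ p.support, x ∈ {x | x ≠ u} := fun x hx h => hu (h ▸ hx)
    have hreach := (p.induce {x | x ≠ u} hs).reachable
    refine hr ⟨r, hs r p.start_mem_support⟩ ?_ rfl
    rw [SimpleGraph.ConnectedComponent.mem_supp_iff] at hw ⊢
    exact (SimpleGraph.ConnectedComponent.sound hreach).trans hw
  rw [← hp]
  exact (SimpleGraph.dist_le (p.takeUntil u hu)).trans_lt
    (SimpleGraph.Walk.length_takeUntil_lt_length hu w.2.symm)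

/-- A component of `T - u` all of whose vertices have degree at most `2` in the acyclic
graph `T` is a pendant path at `u`. -/
theorem isPendantPathComponent_of_degree_le_two {T : SimpleGraph V} [DecidableRel T.Adj]
    (hT : T.IsAcyclic) {u : V} {c : (T.induce {x | x ≠ u}).ConnectedComponent}
    (hdeg : ∀ w ∈ c.supp, T.degree w.1 ≤ 2) : IsPendantPathComponent T u c := by
  have hinj : Function.Injective (fun w : c.supp => w.1.1) :=
    Subtype.val_injective.comp Subtype.val_injective
  have hsub : ∀ w : c.supp,
      (fun w : c.supp => w.1.1) '' (((T.induce {x | x ≠ u}).induce c.supp).neighborSet w) ⊆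
        (((T.neighborFinset w.1.1).erase u : Finset V) : Set V) := by
    rintro w _ ⟨x, hx, rfl⟩
    rw [Finset.mem_coe, Finset.mem_erase, SimpleGraph.mem_neighborFinset]
    exact ⟨x.1.2, hx⟩
  have hcard : ∀ w : c.supp,
      (((T.induce {x | x ≠ u}).induce c.supp).neighborSet w).ncard ≤
        ((T.neighborFinset w.1.1).erase u).card := fun w => by
    rw [← Set.ncard_image_of_injective _ hinj, ← Set.ncard_coe_finset]
    exact Set.ncard_le_ncard (hsub w) (Finset.finite_toSet _)
  refine ⟨c.connected_toSimpleGraph, (hT.induce _).induce _, fun w => ?_, fun w hw => ?_⟩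
  · exact (hcard w).trans ((Finset.card_erase_le).trans (hdeg w.1 w.2))
  · refine (hcard w).trans ?_
    rw [Finset.card_erase_of_mem ((T.mem_neighborFinset _ _).2 hw.symm),
      SimpleGraph.card_neighborFinset_eq_degree]
    have := hdeg w.1 w.2
    omega

/-- every finite tree with a vertex of degree at least `3`
has a vertex `u` of degree at least `3` such that at least `deg(u) - 1` of
the components of `T - u` are pendant paths at `u`; in particular at least
two components are pendant paths and at most one component is not. -/
theorem tree_pendant_paths (T : SimpleGraph V) [DecidableRel T.Adj]
    (hT : T.IsTree) (h3 : ∃ u, 3 ≤ T.degree u) :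
    ∃ u : V, 3 ≤ T.degree u ∧
      T.degree u - 1 ≤
        {c : (T.induce {x | x ≠ u}).ConnectedComponent |
          IsPendantPathComponent T u c}.ncard ∧
      (∃ c₁ c₂ : (T.induce {x | x ≠ u}).ConnectedComponent, c₁ ≠ c₂ ∧
        IsPendantPathComponent T u c₁ ∧ IsPendantPathComponent T u c₂) ∧
      (∀ c₁ c₂ : (T.induce {x | x ≠ u}).ConnectedComponent,
        ¬ IsPendantPathComponent T u c₁ → ¬ IsPendantPathComponent T u c₂ →
          c₁ = c₂) := by
  obtain ⟨r, hr⟩ := h3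
  obtain ⟨u, hu, hmax⟩ := (univ.filter fun v => 3 ≤ T.degree v).exists_max_image (T.dist r)
    ⟨r, mem_filter.2 ⟨mem_univ r, hr⟩⟩
  replace hu : 3 ≤ T.degree u := (mem_filter.1 hu).2
  have hbad : ∀ c : (T.induce {x | x ≠ u}).ConnectedComponent,
      ¬ IsPendantPathComponent T u c → ∃ x ∈ c.supp, x.1 = r := by
    intro c hc
    by_contra! hrc
    refine hc (isPendantPathComponent_of_degree_le_two hT.isAcyclic fun w hw => ?_)
    by_contra hdeg
    exact absurd (dist_lt_dist_of_mem_supp hT.connected hrc hw)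
      (hmax w.1 (mem_filter.2 ⟨mem_univ _, by omega⟩)).not_gt
  have huniq : ∀ c₁ c₂ : (T.induce {x | x ≠ u}).ConnectedComponent,
      ¬ IsPendantPathComponent T u c₁ → ¬ IsPendantPathComponent T u c₂ → c₁ = c₂ := by
    intro c₁ c₂ h₁ h₂
    obtain ⟨x, hx, hxr⟩ := hbad c₁ h₁
    obtain ⟨y, hy, hyr⟩ := hbad c₂ h₂
    obtain rfl : x = y := Subtype.ext (hxr.trans hyr.symm)
    exact hx.symm.trans hy
  have hcard : T.degree u - 1 ≤
      {c : (T.induce {x | x ≠ u}).ConnectedComponent | IsPendantPathComponent T u c}.ncard := by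
    have hle := degree_le_card_connectedComponent_induce_ne hT.isAcyclic u
    have hsum := Set.ncard_add_ncard_compl
      {c : (T.induce {x | x ≠ u}).ConnectedComponent | IsPendantPathComponent T u c}
    have hone : ({c : (T.induce {x | x ≠ u}).ConnectedComponent |
        IsPendantPathComponent T u c}ᶜ).ncard ≤ 1 :=
      (Set.ncard_le_one_iff (Set.toFinite _)).2 fun h₁ h₂ => huniq _ _ h₁ h₂
    omega
  refine ⟨u, hu, hcard, ?_, huniq⟩
  obtain ⟨c₁, c₂, h₁, h₂, hne⟩ := (Set.one_lt_ncard_iff (Set.toFinite _)).1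
    ((show 1 < T.degree u - 1 by omega).trans_le hcard)
  exact ⟨c₁, c₂, hne, h₁, h₂⟩
end
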